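/- arXiv:2412.06111 — 3 statements merged into one kernel-verified Lean document; each statement's English description precedes it below -/
import Mathlib

section
/- Let A ∈ ℝ^{m×n}, B ∈ ℝ^{m×q}, X ∈ ℝ^{n×r} and Y ∈ ℝ^{m×s} be real matrices, and assume that M := Yᵀ A X has full column rank r. Let Q ∈ ℝ^{m×r} and R ∈ ℝ^{r×r} satisfy Qᵀ Q = I_r and A X = Q R, and let Q_⊥ ∈ ℝ^{m×(m−r)} be an orthogonal completion of Q. Define the oblique projector P := A X M† Yᵀ, where M† = (MᵀM)⁻¹Mᵀ. Then Yᵀ Q has full column rank, and ‖P B‖_F ≤ ‖B‖_F · (1 + ‖(Yᵀ Q)† (Yᵀ Q_⊥)‖₂), where (Yᵀ Q)† = ((YᵀQ)ᵀ(YᵀQ))⁻¹(YᵀQ)ᵀ. -/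
open scoped BigOperators Matrix

/-- Frobenius norm of a real matrix. -/
noncomputable def frobNorm {α β : Type*} [Fintype α] [Fintype β] (M : Matrix α β ℝ) : ℝ :=
  Real.sqrt (∑ i, ∑ j, (M i j) ^ 2)

/-- Spectral norm (operator norm induced by Euclidean vector norms). -/
noncomputable def specNorm {α β : Type*} [Fintype α] [Fintype β] [DecidableEq β]
    (M : Matrix α β ℝ) : ℝ :=
  ‖(Matrix.toEuclideanLin M).toContinuousLinearMap‖

/-- Moore–Penrose pseudoinverse of a full-column-rank matrix: `(MᵀM)⁻¹Mᵀ`. -/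
noncomputable def pinvCol {α β : Type*} [Fintype α] [Fintype β] [DecidableEq β]
    (M : Matrix α β ℝ) : Matrix β α ℝ := (Mᵀ * M)⁻¹ * Mᵀ

theorem frobNorm_eq_sqrt_trace {α β : Type*} [Fintype α] [Fintype β] (M : Matrix α β ℝ) :
    frobNorm M = √(Mᵀ * M).trace := by
  rw [frobNorm, Finset.sum_comm]
  simp only [Matrix.trace, Matrix.diag_apply, Matrix.mul_apply, Matrix.transpose_apply, sq]

theorem frobNorm_add_le {α β : Type*} [Fintype α] [Fintype β] (M N : Matrix α β ℝ) :
    frobNorm (M + N) ≤ frobNorm M + frobNorm N := by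
  letI : NormedAddCommGroup (Matrix α β ℝ) := Matrix.frobeniusNormedAddCommGroup
  have h (K : Matrix α β ℝ) : frobNorm K = ‖K‖ := by
    simp [frobNorm, Matrix.frobenius_norm_def, Real.sqrt_eq_rpow]
  simpa only [h] using norm_add_le M N

/-- Left multiplication by a matrix with orthonormal columns preserves the Frobenius norm. -/
theorem frobNorm_mul_of_transpose_mul_self {α β γ : Type*} [Fintype α] [Fintype β] [Fintype γ]
    [DecidableEq β] {Q : Matrix α β ℝ} (hQ : Qᵀ * Q = 1) (C : Matrix β γ ℝ) :
    frobNorm (Q * C) = frobNorm C := by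
  rw [frobNorm_eq_sqrt_trace, frobNorm_eq_sqrt_trace, Matrix.transpose_mul, Matrix.mul_assoc,
    ← Matrix.mul_assoc Qᵀ, hQ, Matrix.one_mul]

theorem frobNorm_transpose_mul_le {α β γ δ : Type*} [Fintype α] [Fintype β] [Fintype γ]
    [Fintype δ] [DecidableEq α] {U : Matrix α β ℝ} {V : Matrix α δ ℝ}
    (h : U * Uᵀ + V * Vᵀ = 1) (B : Matrix α γ ℝ) :
    frobNorm (Uᵀ * B) ≤ frobNorm B := by
  rw [frobNorm_eq_sqrt_trace, frobNorm_eq_sqrt_trace]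
  apply Real.sqrt_le_sqrt
  have hB : Bᵀ * B = (Uᵀ * B)ᵀ * (Uᵀ * B) + (Vᵀ * B)ᵀ * (Vᵀ * B) := by
    calc Bᵀ * B = Bᵀ * (U * Uᵀ + V * Vᵀ) * B := by rw [h, Matrix.mul_one]
      _ = _ := by
        simp only [Matrix.transpose_mul, Matrix.transpose_transpose, Matrix.mul_add,
          Matrix.add_mul, Matrix.mul_assoc]
  have hV : 0 ≤ ((Vᵀ * B)ᵀ * (Vᵀ * B)).trace := by
    simpa using (Matrix.posSemidef_conjTranspose_mul_self (Vᵀ * B)).trace_nonneg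
  rw [hB, Matrix.trace_add]
  linarith

theorem specNorm_nonneg {α β : Type*} [Fintype α] [Fintype β] [DecidableEq β]
    (M : Matrix α β ℝ) : 0 ≤ specNorm M :=
  norm_nonneg _

theorem frobNorm_mul_le {α β γ : Type*} [Fintype α] [Fintype β] [Fintype γ] [DecidableEq β]
    (S : Matrix α β ℝ) (C : Matrix β γ ℝ) :
    frobNorm (S * C) ≤ specNorm S * frobNorm C := by
  have hcol (j : γ) : ∑ i, (S * C) i j ^ 2 ≤ specNorm S ^ 2 * ∑ i, C i j ^ 2 := by
    have h := (Matrix.toEuclideanLin S).toContinuousLinearMap.le_opNorm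
      (WithLp.toLp 2 fun i => C i j)
    have h2 := pow_le_pow_left₀ (norm_nonneg _) h 2
    rw [mul_pow, EuclideanSpace.norm_sq_eq, EuclideanSpace.norm_sq_eq] at h2
    simpa [specNorm, Matrix.mulVec, dotProduct, Matrix.mul_apply] using h2
  rw [frobNorm, frobNorm]
  apply Real.sqrt_le_iff.mpr
  refine ⟨mul_nonneg (specNorm_nonneg S) (Real.sqrt_nonneg _), ?_⟩
  rw [mul_pow, Real.sq_sqrt (by positivity), Finset.sum_comm,
    Finset.sum_comm (f := fun i j => C i j ^ 2), Finset.mul_sum]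
  exact Finset.sum_le_sum fun j _ => hcol j

theorem isUnit_of_rank_eq_card {β : Type*} [Fintype β] [DecidableEq β] {M : Matrix β β ℝ}
    (h : M.rank = Fintype.card β) : IsUnit M := by
  rw [← Matrix.linearIndependent_cols_iff_isUnit, linearIndependent_iff_card_eq_finrank_span, ← h,
    Matrix.rank_eq_finrank_span_cols]
  rfl

theorem pinvCol_mul_self {α β : Type*} [Fintype α] [Fintype β] [DecidableEq β]
    {M : Matrix α β ℝ} (h : M.rank = Fintype.card β) : pinvCol M * M = 1 := by
  rw [pinvCol, Matrix.mul_assoc]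
  refine Matrix.nonsing_inv_mul _ ((Matrix.isUnit_iff_isUnit_det _).mp (isUnit_of_rank_eq_card ?_))
  rw [Matrix.rank_transpose_mul_self, h]

theorem pinvCol_mul_of_isUnit {α β : Type*} [Fintype α] [Fintype β] [DecidableEq β]
    (N : Matrix α β ℝ) {R : Matrix β β ℝ} (hR : IsUnit R) :
    pinvCol (N * R) = R⁻¹ * pinvCol N := by
  have hRt : IsUnit Rᵀ.det := by
    rw [Matrix.det_transpose]
    exact (Matrix.isUnit_iff_isUnit_det _).mp hR
  have hG : (N * R)ᵀ * (N * R) = Rᵀ * (Nᵀ * N * R) := by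
    simp only [Matrix.transpose_mul, Matrix.mul_assoc]
  rw [pinvCol, pinvCol, hG, Matrix.mul_inv_rev, Matrix.mul_inv_rev, Matrix.transpose_mul,
    Matrix.mul_assoc, ← Matrix.mul_assoc _ Rᵀ, Matrix.nonsing_inv_mul _ hRt, Matrix.one_mul,
    Matrix.mul_assoc]

/-- Lemma 5.1 (removable projections): if `M = Yᵀ A X` has full column rank,
`A X = Q R` with `QᵀQ = I`, and `Q_⊥` is an orthogonal completion of `Q`, then
`Yᵀ Q` has full column rank and
`‖A X M† Yᵀ B‖_F ≤ ‖B‖_F (1 + ‖(YᵀQ)† (YᵀQ_⊥)‖₂)`. -/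
theorem removable_projection_bound
    {m n r s q : ℕ}
    (A : Matrix (Fin m) (Fin n) ℝ) (B : Matrix (Fin m) (Fin q) ℝ)
    (X : Matrix (Fin n) (Fin r) ℝ) (Y : Matrix (Fin m) (Fin s) ℝ)
    (hM : (Yᵀ * A * X).rank = r)
    (Q : Matrix (Fin m) (Fin r) ℝ) (R : Matrix (Fin r) (Fin r) ℝ)
    (hQ : Qᵀ * Q = 1) (hQR : A * X = Q * R)
    (Qp : Matrix (Fin m) (Fin (m - r)) ℝ)
    (hQp : Qpᵀ * Qp = 1) (hQQp : Qᵀ * Qp = 0)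
    (hcomp : Q * Qᵀ + Qp * Qpᵀ = 1) :
    (Yᵀ * Q).rank = r ∧
      frobNorm (A * X * pinvCol (Yᵀ * A * X) * Yᵀ * B) ≤
        frobNorm B * (1 + specNorm (pinvCol (Yᵀ * Q) * (Yᵀ * Qp))) := by
  have hMN : Yᵀ * A * X = Yᵀ * Q * R := by
    rw [Matrix.mul_assoc, hQR, Matrix.mul_assoc]
  rw [hMN] at hM
  have hN : (Yᵀ * Q).rank = r :=
    le_antisymm (Matrix.rank_le_width _) (hM.symm.le.trans (Matrix.rank_mul_le_left _ _))
  have hR : IsUnit R := isUnit_of_rank_eq_card <| by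
    rw [Fintype.card_fin]
    exact le_antisymm (Matrix.rank_le_width _) (hM.symm.le.trans (Matrix.rank_mul_le_right _ _))
  refine ⟨hN, ?_⟩
  have hNN : pinvCol (Yᵀ * Q) * (Yᵀ * Q) = 1 := pinvCol_mul_self (by rw [hN, Fintype.card_fin])
  set S := pinvCol (Yᵀ * Q) * (Yᵀ * Qp) with hS
  have hY : pinvCol (Yᵀ * Q) * Yᵀ = Qᵀ + S * Qpᵀ := by
    calc pinvCol (Yᵀ * Q) * Yᵀ
        = pinvCol (Yᵀ * Q) * Yᵀ * (Q * Qᵀ + Qp * Qpᵀ) := by rw [hcomp, Matrix.mul_one]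
      _ = pinvCol (Yᵀ * Q) * (Yᵀ * Q) * Qᵀ + S * Qpᵀ := by
        simp only [hS, Matrix.mul_add, Matrix.mul_assoc]
      _ = Qᵀ + S * Qpᵀ := by rw [hNN, Matrix.one_mul]
  have hP : A * X * pinvCol (Yᵀ * A * X) * Yᵀ * B = Q * (Qᵀ * B + S * (Qpᵀ * B)) := by
    calc A * X * pinvCol (Yᵀ * A * X) * Yᵀ * B
        = Q * (R * R⁻¹) * (pinvCol (Yᵀ * Q) * Yᵀ) * B := by
          rw [hMN, pinvCol_mul_of_isUnit _ hR, hQR]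
          simp only [Matrix.mul_assoc]
      _ = Q * (Qᵀ * B + S * (Qpᵀ * B)) := by
          rw [Matrix.mul_nonsing_inv _ ((Matrix.isUnit_iff_isUnit_det _).mp hR), hY,
            Matrix.mul_one, Matrix.mul_assoc, Matrix.add_mul, Matrix.mul_assoc]
  rw [hP, frobNorm_mul_of_transpose_mul_self hQ]
  calc frobNorm (Qᵀ * B + S * (Qpᵀ * B))
      ≤ frobNorm (Qᵀ * B) + specNorm S * frobNorm (Qpᵀ * B) :=
        (frobNorm_add_le _ _).trans (by gcongr; exact frobNorm_mul_le _ _)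
    _ ≤ frobNorm B + specNorm S * frobNorm B := by
        gcongr
        · exact frobNorm_transpose_mul_le hcomp B
        · exact specNorm_nonneg S
        · exact frobNorm_transpose_mul_le ((add_comm _ _).trans hcomp) B
    _ = frobNorm B * (1 + specNorm S) := by ring
end

section
/- Let A ∈ ℝ^{m×n}, X ∈ ℝ^{n×r} and Y ∈ ℝ^{m×s} be real matrices, and assume that M := Yᵀ A X has full column rank r. Let Q ∈ ℝ^{m×r} and R ∈ ℝ^{r×r} satisfy Qᵀ Q = I_r and A X = Q R. Then R is invertible, Yᵀ Q has full column rank, and A X M† Yᵀ = Q (Yᵀ Q)† Yᵀ, where M† = (MᵀM)⁻¹Mᵀ and (Yᵀ Q)† = ((YᵀQ)ᵀ(YᵀQ))⁻¹(YᵀQ)ᵀ. -/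
open scoped BigOperators Matrix

/-- A square matrix of full rank over a field is invertible. -/
theorem isUnit_of_card_le_rank {K β : Type*} [Field K] [Fintype β] [DecidableEq β]
    {R : Matrix β β K} (h : Fintype.card β ≤ R.rank) : IsUnit R := by
  rw [← Matrix.mulVec_surjective_iff_isUnit]
  have htop : LinearMap.range R.mulVecLin = ⊤ :=
    Submodule.eq_top_of_finrank_eq <| by
      rw [Module.finrank_fintype_fun_eq_card]
      exact le_antisymm R.rank_le_card_width h
  exact LinearMap.range_eq_top.mp htop

/-- Right multiplication by an invertible matrix passes through the pseudoinverse. -/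
theorem mul_pinvCol_mul_of_isUnit {α β : Type*} [Fintype α] [Fintype β] [DecidableEq β]
    (N : Matrix α β ℝ) {R : Matrix β β ℝ} (hR : IsUnit R) :
    R * pinvCol (N * R) = pinvCol N := by
  have hdet : IsUnit R.det := (Matrix.isUnit_iff_isUnit_det R).mp hR
  have hdetT : IsUnit Rᵀ.det := by rwa [Matrix.det_transpose]
  have hgram : (N * R)ᵀ * (N * R) = Rᵀ * ((Nᵀ * N) * R) := by
    simp only [Matrix.transpose_mul, Matrix.mul_assoc]
  rw [pinvCol, hgram, Matrix.mul_inv_rev, Matrix.mul_inv_rev, Matrix.transpose_mul, pinvCol]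
  simp only [Matrix.mul_assoc]
  rw [Matrix.mul_nonsing_inv_cancel_left _ _ hdet, Matrix.nonsing_inv_mul_cancel_left _ _ hdetT]

/-- If `M = Yᵀ A X` has full column rank and `A X = Q R` with `QᵀQ = I`, then `R` is
invertible, `Yᵀ Q` has full column rank, and `A X M† Yᵀ = Q (YᵀQ)† Yᵀ`. -/
theorem nystrom_projector_factorization
    {m n r s : ℕ}
    (A : Matrix (Fin m) (Fin n) ℝ)
    (X : Matrix (Fin n) (Fin r) ℝ) (Y : Matrix (Fin m) (Fin s) ℝ)
    (hM : (Yᵀ * A * X).rank = r)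
    (Q : Matrix (Fin m) (Fin r) ℝ) (R : Matrix (Fin r) (Fin r) ℝ)
    (hQ : Qᵀ * Q = 1) (hQR : A * X = Q * R) :
    IsUnit R ∧ (Yᵀ * Q).rank = r ∧
      A * X * pinvCol (Yᵀ * A * X) * Yᵀ = Q * pinvCol (Yᵀ * Q) * Yᵀ := by
  have hfac : Yᵀ * A * X = Yᵀ * Q * R := by
    rw [Matrix.mul_assoc, hQR, Matrix.mul_assoc]
  rw [hfac] at hM
  have hR : IsUnit R := isUnit_of_card_le_rank <| by
    simpa using hM.symm.le.trans (Matrix.rank_mul_le_right _ _)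
  refine ⟨hR, le_antisymm (Matrix.rank_le_width _) ?_, ?_⟩
  · exact hM.symm.le.trans (Matrix.rank_mul_le_left _ _)
  · rw [hfac, hQR, Matrix.mul_assoc Q, mul_pinvCol_mul_of_isUnit _ hR]
end

section
/- Let T be an order-K real tensor with mode sizes m_1,…,m_K and let P_k ∈ ℝ^{m_k×m_k} for k = 1,…,K be arbitrary square matrices. For each k define the tensor T_k := (A_1^{(k)} ⊗ … ⊗ A_K^{(k)})·T, where A_i^{(k)} = I_{m_i} for i < k, A_k^{(k)} = I_{m_k} − P_k, and A_i^{(k)} = P_i for i > k. Then ‖T − (P_1 ⊗ … ⊗ P_K)·T‖_F ≤ Σ_{k=1}^K ‖T_k‖_F. -/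
open scoped BigOperators Matrix

/-- Frobenius norm of an order-`K` tensor. -/
noncomputable def tnorm {K : ℕ} {m : Fin K → ℕ} (T : (∀ k, Fin (m k)) → ℝ) : ℝ :=
  Real.sqrt (∑ x, (T x) ^ 2)

/-- Action of a Kronecker product of square matrices on an order-`K` tensor:
`((A_1 ⊗ … ⊗ A_K)·T)(x) = Σ_y (Π_k (A_k)_{x_k, y_k}) T(y)`. -/
noncomputable def kronAct {K : ℕ} {m : Fin K → ℕ}
    (P : ∀ k, Matrix (Fin (m k)) (Fin (m k)) ℝ)
    (T : (∀ k, Fin (m k)) → ℝ) : (∀ k, Fin (m k)) → ℝ :=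
  fun x => ∑ y, (∏ k, P k (x k) (y k)) * T y

theorem tnorm_eq_norm_toLp {K : ℕ} {m : Fin K → ℕ} (T : (∀ k, Fin (m k)) → ℝ) :
    tnorm T = ‖WithLp.toLp 2 T‖ := by
  simp [tnorm, EuclideanSpace.norm_eq]

theorem tnorm_sum_le {K : ℕ} {m : Fin K → ℕ} {ι : Type*} (s : Finset ι)
    (T : ι → (∀ k, Fin (m k)) → ℝ) :
    tnorm (∑ i ∈ s, T i) ≤ ∑ i ∈ s, tnorm (T i) := by
  simp only [tnorm_eq_norm_toLp, WithLp.toLp_sum]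
  exact norm_sum_le _ _

theorem prod_matrix_one_apply {ι R : Type*} [Fintype ι] [CommRing R] {n : ι → Type*}
    [∀ i, DecidableEq (n i)] (x y : ∀ i, n i) :
    ∏ i, (1 : Matrix (n i) (n i) R) (x i) (y i) = if x = y then 1 else 0 := by
  classical
  simp only [Matrix.one_apply, Finset.prod_ite_zero, Finset.prod_const_one, Finset.mem_univ,
    true_imp_iff, funext_iff]

/-- Applying the identity in every mode does nothing. -/
theorem kronAct_one {K : ℕ} {m : Fin K → ℕ} (T : (∀ k, Fin (m k)) → ℝ) :
    kronAct (fun _ => 1) T = T := by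
  ext x
  simp [kronAct, prod_matrix_one_apply]

/-- The telescoping identity for products, with the factors `a i` swapped for `b i` one at a
time. -/
theorem prod_sub_prod_eq_sum_prod_ite {ι R : Type*} [Fintype ι] [LinearOrder ι] [CommRing R]
    (a b : ι → R) :
    ∏ i, a i - ∏ i, b i =
      ∑ k, ∏ i, if i < k then a i else if i = k then a i - b i else b i := by
  have h := Finset.prod_add_ordered Finset.univ b (fun i => a i - b i)
  simp only [add_sub_cancel] at h
  rw [h, add_sub_cancel_left]
  refine Finset.sum_congr rfl fun k _ => ?_
  rw [Finset.prod_ite, Finset.prod_ite, Finset.filter_filter, Finset.filter_filter]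
  have h_eq : Finset.univ.filter (fun i => ¬i < k ∧ i = k) = {k} := by
    ext i; simp +contextual
  have h_gt : Finset.univ.filter (fun i => ¬i < k ∧ ¬i = k) = Finset.univ.filter (k < ·) := by
    ext i; simpa [eq_comm] using lt_iff_le_and_ne.symm
  rw [h_eq, h_gt, Finset.prod_singleton]
  ring

/-- The telescoping identity for Kronecker products acting on a tensor. -/
theorem sub_kronAct_eq_sum {K : ℕ} {m : Fin K → ℕ} (T : (∀ k, Fin (m k)) → ℝ)
    (P : ∀ k, Matrix (Fin (m k)) (Fin (m k)) ℝ) :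
    T - kronAct P T =
      ∑ k : Fin K, kronAct
        (fun i => if i < k then (1 : Matrix (Fin (m i)) (Fin (m i)) ℝ)
          else if i = k then 1 - P i else P i) T := by
  nth_rewrite 1 [← kronAct_one T]
  ext x
  simp only [kronAct, Pi.sub_apply, Finset.sum_apply]
  rw [Finset.sum_comm, ← Finset.sum_sub_distrib]
  refine Finset.sum_congr rfl fun y _ => ?_
  rw [← sub_mul, ← Finset.sum_mul, prod_sub_prod_eq_sum_prod_ite]
  congr 1
  refine Finset.sum_congr rfl fun k _ => Finset.prod_congr rfl fun i _ => ?_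
  split_ifs <;> rfl

/-- Telescoping bound: `‖T − (P_1 ⊗ … ⊗ P_K)·T‖_F ≤ Σ_k ‖T_k‖_F`, where `T_k` is obtained
from `T` by applying the identity in modes `i < k`, `I − P_k` in mode `k`, and `P_i` in
modes `i > k`. -/
theorem kron_telescoping_bound {K : ℕ} {m : Fin K → ℕ}
    (T : (∀ k, Fin (m k)) → ℝ)
    (P : ∀ k, Matrix (Fin (m k)) (Fin (m k)) ℝ) :
    tnorm (fun x => T x - kronAct P T x) ≤
      ∑ k : Fin K, tnorm (kronAct
        (fun i => if i < k then (1 : Matrix (Fin (m i)) (Fin (m i)) ℝ)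
          else if i = k then 1 - P i else P i) T) := by
  change tnorm (T - kronAct P T) ≤ _
  rw [sub_kronAct_eq_sum]
  exact tnorm_sum_le _ _
end
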